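/- Let S be a path-connected topological space and I ⊆ C[x₁,…,xₙ](S) a Groebner ideal with respect to a fixed monomial ordering. Then for any s, s' ∈ S, the ideals of leading terms coincide: ⟨LT(h) : h ∈ I|_s, h ≠ 0⟩ = ⟨LT(h) : h ∈ I|_{s'}, h ≠ 0⟩ in ℂ[x₁,…,xₙ]; consequently the Krull dimension of ℂ[x₁,…,xₙ]/I|_s is the same for all s ∈ S. -/

import Mathlib

open MvPolynomial

noncomputable section

/-- Evaluation of continuous functions at a point, as a ring homomorphism. -/
def evalAt {S : Type} [TopologicalSpace S] (s : S) : C(S, ℂ) →+* ℂ where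
  toFun f := f s
  map_one' := rfl
  map_mul' _ _ := rfl
  map_zero' := rfl
  map_add' _ _ := rfl

/-- Coefficientwise evaluation at `s`, sending `f ∈ C[x₁,…,xₙ](S)` to the fibre
polynomial `f_s ∈ ℂ[x₁,…,xₙ]`. -/
def fiberMap {S : Type} [TopologicalSpace S] (n : ℕ) (s : S) :
    MvPolynomial (Fin n) C(S, ℂ) →+* MvPolynomial (Fin n) ℂ :=
  MvPolynomial.map (evalAt s)

/-- The multidegree (largest exponent of a monomial with nonzero coefficient) of a
polynomial with respect to a monomial order. -/
def mDegree {σ R : Type*} [CommSemiring R] (mo : MonomialOrder σ)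
    (f : MvPolynomial σ R) : σ →₀ ℕ :=
  mo.toSyn.symm (f.support.sup fun α => mo.toSyn α)

/-- The leading coefficient of `f` with respect to a monomial order. -/
def mLC {σ R : Type*} [CommSemiring R] (mo : MonomialOrder σ) (f : MvPolynomial σ R) : R :=
  f.coeff (mDegree mo f)

/-- The leading term `LT(f) = LC(f)·LM(f)` of `f` with respect to a monomial order. -/
def mLT {σ R : Type*} [CommSemiring R] (mo : MonomialOrder σ) (f : MvPolynomial σ R) :
    MvPolynomial σ R :=
  MvPolynomial.monomial (mDegree mo f) (mLC mo f)

/-- The ideal of leading terms `⟨LT(f) : f ∈ I, f ≠ 0⟩`. -/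
def ltIdeal {σ R : Type*} [CommRing R] (mo : MonomialOrder σ)
    (I : Ideal (MvPolynomial σ R)) : Ideal (MvPolynomial σ R) :=
  Ideal.span {p | ∃ f ∈ I, f ≠ 0 ∧ p = mLT mo f}

/-- `G` is a Groebner basis of the ideal `I ⊆ C[x_σ](T)`: it generates `I`, each leading
term is nonvanishing on `T`, and its leading terms generate the ideal of leading terms. -/
def IsGroebnerBasis {σ : Type*} (T : Type) [TopologicalSpace T] (mo : MonomialOrder σ)
    (I : Ideal (MvPolynomial σ C(T, ℂ))) (G : Finset (MvPolynomial σ C(T, ℂ))) : Prop :=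
  Ideal.span (G : Set (MvPolynomial σ C(T, ℂ))) = I ∧
  (∀ g ∈ G, ∀ t : T, mLC mo g t ≠ 0) ∧
  Ideal.span (mLT mo '' (G : Set (MvPolynomial σ C(T, ℂ)))) = ltIdeal mo I

/-- An ideal admitting a Groebner basis. -/
def IsGroebnerIdeal {σ : Type*} (T : Type) [TopologicalSpace T] (mo : MonomialOrder σ)
    (I : Ideal (MvPolynomial σ C(T, ℂ))) : Prop :=
  ∃ G : Finset (MvPolynomial σ C(T, ℂ)), IsGroebnerBasis T mo I G

theorem ringKrullDim_eq_of_isIntegral_of_injective {R A : Type*} [CommRing R] [CommRing A]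
    [Algebra R A] [Algebra.IsIntegral R A] (h : Function.Injective (algebraMap R A)) :
    ringKrullDim R = ringKrullDim A := by
  apply le_antisymm
  · refine iSup_le fun l => ?_
    obtain ⟨Q, -, hQ, hQl⟩ := Ideal.exists_ideal_over_prime_of_isIntegral
      (RelSeries.head l).asIdeal (⊥ : Ideal A)
      (by rw [← RingHom.ker_eq_comap_bot, (RingHom.injective_iff_ker_eq_bot _).mp h]; exact bot_le)
    have : Q.LiesOver (RelSeries.head l).asIdeal := ⟨hQl.symm⟩
    obtain ⟨L, hL, -⟩ := Ideal.exists_ltSeries_of_hasGoingUp l Q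
    rw [← hL]
    exact Order.LTSeries.length_le_krullDim L
  · exact Order.krullDim_le_of_strictMono (PrimeSpectrum.comap (algebraMap R A))
      fun P Q hPQ => Ideal.IsIntegral.comap_lt_comap hPQ

theorem ringKrullDim_eq_of_algHom_finite {k R A : Type*} [CommRing k] [CommRing R] [CommRing A]
    [Algebra k R] [Algebra k A] (g : R →ₐ[k] A) (hg : Function.Injective g) (hfin : g.Finite) :
    ringKrullDim R = ringKrullDim A := by
  algebraize [g.toRingHom]
  have : Module.Finite R A := hfin
  exact ringKrullDim_eq_of_isIntegral_of_injective hg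

theorem exists_nonneg_combination_of_forall_nonpos {W ι : Type*} [AddCommGroup W] (s : Finset ι)
    (a : ι → W →+ ℤ) (b : W →+ ℤ) (h : ∀ x, (∀ i ∈ s, a i x ≤ 0) → b x ≤ 0) :
    ∃ c : ℕ, 0 < c ∧ ∃ l : ι → ℕ, ∀ x, c * b x = ∑ i ∈ s, l i * a i x := by
  classical
  induction s using Finset.induction_on generalizing a b with
  | empty =>
    refine ⟨1, one_pos, 0, fun x => ?_⟩
    have h1 := h x (by simp)
    have h2 := h (-x) (by simp)
    rw [map_neg] at h2
    simp only [Finset.sum_empty]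
    push_cast
    linarith
  | insert j s hj ih =>
    by_cases hs : ∀ x, (∀ i ∈ s, a i x ≤ 0) → b x ≤ 0
    · obtain ⟨c, hc, l, hl⟩ := ih a b hs
      refine ⟨c, hc, fun i => if i = j then 0 else l i, fun x => ?_⟩
      rw [hl, Finset.sum_insert hj]
      simp only [if_true, Nat.cast_zero, zero_mul, zero_add]
      refine Finset.sum_congr rfl fun i hi => ?_
      rw [if_neg (ne_of_mem_of_not_mem hi hj)]
    · push Not at hs
      obtain ⟨y, hy, hby⟩ := hs
      have hjy : 0 < a j y := by
        by_contra hcon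
        refine absurd (h y fun i hi => ?_) (not_le.mpr hby)
        rcases Finset.mem_insert.mp hi with rfl | hi
        · exact not_lt.mp hcon
        · exact hy i hi
      obtain ⟨c, hc, l, hl⟩ := ih (fun i => a j y • a i - a i y • a j) (a j y • b - b y • a j)
        (fun x hx => by
          have := h (a j y • x - a j x • y) (fun i hi => by
            rcases Finset.mem_insert.mp hi with rfl | hi
            · simp [mul_comm]
            · have := hx i hi
              simp only [AddMonoidHom.sub_apply, AddMonoidHom.smul_apply, smul_eq_mul] at this
              simp only [map_sub, map_zsmul, smul_eq_mul]
              linarith)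
          simp only [map_sub, map_zsmul, smul_eq_mul] at this
          simp only [AddMonoidHom.sub_apply, AddMonoidHom.smul_apply, smul_eq_mul]
          linarith)
      set d : ℤ := c * b y - ∑ i ∈ s, l i * a i y with hd
      have hd0 : 0 ≤ d := by
        have : ∑ i ∈ s, (l i : ℤ) * a i y ≤ 0 :=
          Finset.sum_nonpos fun i hi => mul_nonpos_of_nonneg_of_nonpos (by positivity) (hy i hi)
        have : 0 ≤ (c : ℤ) * b y := by positivity
        linarith
      refine ⟨c * (a j y).toNat, Nat.mul_pos hc (by omega),
        fun i => if i = j then d.toNat else l i * (a j y).toNat, fun x => ?_⟩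
      have hlx := hl x
      simp only [AddMonoidHom.sub_apply, AddMonoidHom.smul_apply, smul_eq_mul] at hlx
      rw [Finset.sum_insert hj, Finset.sum_congr rfl (g := fun i => l i * a j y * a i x)]
      · simp only [if_true, Nat.cast_mul, Int.toNat_of_nonneg hd0, Int.toNat_of_nonneg hjy.le]
        rw [hd, sub_mul, Finset.sum_mul]
        simp only [mul_sub, Finset.sum_sub_distrib] at hlx
        have e1 : ∑ i ∈ s, (l i : ℤ) * (a j y * a i x) = ∑ i ∈ s, l i * a j y * a i x :=
          Finset.sum_congr rfl fun i _ => by ring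
        have e2 : ∑ i ∈ s, (l i : ℤ) * (a i y * a j x) = ∑ i ∈ s, l i * a i y * a j x :=
          Finset.sum_congr rfl fun i _ => by ring
        rw [e1, e2] at hlx
        linarith
      · intro i hi
        simp only [if_neg (ne_of_mem_of_not_mem hi hj)]
        push_cast
        rw [Int.toNat_of_nonneg hjy.le]

/-- Finitely many comparisons of a monomial order are witnessed by a positive integral weight. -/
theorem MonomialOrder.exists_pos_weight {σ : Type*} [Finite σ] (mo : MonomialOrder σ)
    (P : Finset ((σ →₀ ℕ) × (σ →₀ ℕ))) (hP : ∀ p ∈ P, mo.toSyn p.1 ≤ mo.toSyn p.2) :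
    ∃ w : σ → ℕ, (∀ i, 0 < w i) ∧
      ∀ p ∈ P, Finsupp.weight w p.1 ≤ Finsupp.weight w p.2 := by
  classical
  have := Fintype.ofFinite σ
  let φ : (σ →₀ ℕ) → (σ → ℤ) →+ ℤ := fun a =>
    { toFun := fun x => ∑ i, x i * a i
      map_zero' := by simp
      map_add' := fun x y => by simp [add_mul, Finset.sum_add_distrib] }
  have hφ : ∀ a x, φ a x = ∑ i, x i * a i := fun _ _ => rfl
  let Q := P ∪ Finset.univ.image fun i => ((0 : σ →₀ ℕ), Finsupp.single i 1)
  have hQ : ∀ p ∈ Q, mo.toSyn p.1 ≤ mo.toSyn p.2 := by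
    intro p hp
    rcases Finset.mem_union.mp hp with hp | hp
    · exact hP p hp
    · obtain ⟨i, -, rfl⟩ := Finset.mem_image.mp hp
      simp
  have key : ∀ j, ∃ x : σ → ℤ, (∀ p ∈ Q, φ p.1 x - φ p.2 x ≤ 0) ∧ 0 < x j := by
    intro j
    by_contra! hcon
    obtain ⟨c, hc, l, hl⟩ := exists_nonneg_combination_of_forall_nonpos Q
      (fun p => φ p.1 - φ p.2) (Pi.evalAddMonoidHom (fun _ => ℤ) j) (fun x hx => hcon x hx)
    have hsum : c • Finsupp.single j 1 + ∑ p ∈ Q, l p • p.2 = ∑ p ∈ Q, l p • p.1 := by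
      ext i
      have := hl (Pi.single i 1)
      simp only [AddMonoidHom.sub_apply, hφ, Pi.evalAddMonoidHom_apply, Pi.single_apply, ite_mul,
        one_mul, zero_mul, Finset.sum_ite_eq', Finset.mem_univ, if_true, mul_sub,
        Finset.sum_sub_distrib] at this
      simp only [Finsupp.add_apply, Finsupp.smul_apply, Finsupp.finsetSum_apply, smul_eq_mul,
        Finsupp.single_apply]
      zify
      rw [← sub_eq_iff_eq_add.mp this.symm]
    have hle : mo.toSyn (∑ p ∈ Q, l p • p.1) ≤ mo.toSyn (∑ p ∈ Q, l p • p.2) := by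
      simp only [map_sum, map_nsmul]
      exact Finset.sum_le_sum fun p hp => nsmul_le_nsmul_right (hQ p hp) _
    rw [← hsum, map_add, add_le_iff_nonpos_left, ← MonomialOrder.eq_zero_iff,
      MonomialOrder.toSyn_eq_zero_iff] at hle
    have := DFunLike.congr_fun hle j
    simp at this
    omega
  choose x hx hxj using key
  have hx0 : ∀ j i, 0 ≤ x j i := by
    intro j i
    have := hx j (0, Finsupp.single i 1) (by simp [Q])
    simpa [hφ, Finsupp.single_apply] using this
  have hw0 : ∀ i, 0 ≤ ∑ j, x j i := fun i => Finset.sum_nonneg fun j _ => hx0 j i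
  refine ⟨fun i => (∑ j, x j i).toNat, fun i => ?_, fun p hp => ?_⟩
  · rw [Int.lt_toNat]
    exact Finset.sum_pos' (fun j _ => hx0 j i) ⟨i, Finset.mem_univ _, hxj i⟩
  · have h : ∀ a : σ →₀ ℕ, (Finsupp.weight (fun i => (∑ j, x j i).toNat) a : ℤ) =
        ∑ j, φ a (x j) := by
      intro a
      rw [Finsupp.weight_apply, Finsupp.sum_fintype _ _ (by simp)]
      simp only [hφ, smul_eq_mul]
      push_cast
      rw [Finset.sum_comm]
      refine Finset.sum_congr rfl fun i _ => ?_
      rw [Int.toNat_of_nonneg (hw0 i), Finset.mul_sum]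
      exact Finset.sum_congr rfl fun j _ => mul_comm _ _
    zify
    rw [h, h]
    exact Finset.sum_le_sum fun j _ => by
      linarith [hx j p (Finset.mem_union_left _ hp)]

theorem mk_monomial_mem_span_standard {σ k : Type*} [Field k] (mo : MonomialOrder σ)
    {J : Ideal (MvPolynomial σ k)} {G : Finset (MvPolynomial σ k)}
    (hGJ : ∀ g ∈ G, g ∈ J) (hG0 : ∀ g ∈ G, g ≠ 0) {w : σ → ℕ}
    (hw : ∀ g ∈ G, ∀ m ∈ g.support, Finsupp.weight w m ≤ Finsupp.weight w (mo.degree g))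
    (a : σ →₀ ℕ) :
    Ideal.Quotient.mk J (monomial a 1) ∈ Submodule.span k
      ((fun b => Ideal.Quotient.mk J (monomial b (1 : k))) ''
        {b | (∀ g ∈ G, ¬ mo.degree g ≤ b) ∧ Finsupp.weight w b ≤ Finsupp.weight w a}) := by
  classical
  induction a using (InvImage.wf mo.toSyn wellFounded_lt).induction with
  | _ a ih =>
    by_cases ha : ∀ g ∈ G, ¬ mo.degree g ≤ a
    · exact Submodule.subset_span ⟨a, ⟨ha, le_rfl⟩, rfl⟩
    push Not at ha
    obtain ⟨g, hg, hga⟩ := ha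
    obtain ⟨d, rfl⟩ := exists_add_of_le hga
    have hc : mo.leadingCoeff g ≠ 0 := mo.leadingCoeff_ne_zero_iff.mpr (hG0 g hg)
    have hmem : mo.degree g ∈ g.support := mo.degree_mem_support (hG0 g hg)
    have hzero : Ideal.Quotient.mk J (monomial d 1 * g) = 0 :=
      Ideal.Quotient.eq_zero_iff_mem.mpr (J.mul_mem_left _ (hGJ g hg))
    have hexp : monomial d 1 * g = mo.leadingCoeff g • monomial (mo.degree g + d) (1 : k) +
        ∑ m ∈ g.support.erase (mo.degree g), g.coeff m • monomial (m + d) (1 : k) := by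
      conv_lhs => rw [g.as_sum, Finset.mul_sum]
      rw [← Finset.add_sum_erase _ _ hmem]
      simp [monomial_mul, smul_monomial, add_comm, MonomialOrder.leadingCoeff]
    rw [hexp] at hzero
    have hsum := eq_neg_of_add_eq_zero_left ((map_add _ _ _).symm.trans hzero)
    rw [← Submodule.smul_mem_iff _ hc]
    have hsmul : ∀ (c : k) (p : MvPolynomial σ k),
        Ideal.Quotient.mk J (c • p) = c • Ideal.Quotient.mk J p := fun _ _ => rfl
    rw [← hsmul, hsum, map_sum]
    refine Submodule.neg_mem _ (Submodule.sum_mem _ fun m hm => ?_)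
    obtain ⟨hne, hm⟩ := Finset.mem_erase.mp hm
    rw [hsmul]
    refine Submodule.smul_mem _ _ (Submodule.span_mono (Set.image_mono ?_) (ih (m + d) ?_))
    · rintro b ⟨hb, hbw⟩
      refine ⟨hb, hbw.trans ?_⟩
      rw [map_add, map_add]
      exact Nat.add_le_add_right (hw g hg m hm) _
    · change mo.toSyn (m + d) < mo.toSyn (mo.degree g + d)
      rw [map_add, map_add]
      exact add_lt_add_left (lt_of_le_of_ne (mo.le_degree hm) (mo.toSyn.injective.ne hne)) _

theorem linearIndependent_mk_standard {σ k : Type*} [Field k] (mo : MonomialOrder σ)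
    (J : Ideal (MvPolynomial σ k)) (s : Set (σ →₀ ℕ))
    (hs : ∀ f ∈ J, f ≠ 0 → mo.degree f ∉ s) :
    LinearIndependent k fun b : s => Ideal.Quotient.mk J (monomial (b : σ →₀ ℕ) (1 : k)) := by
  have hli : LinearIndependent k fun b : s => monomial (b : σ →₀ ℕ) (1 : k) :=
    (basisMonomials σ k).linearIndependent.comp _ Subtype.val_injective
  refine hli.map (f := (Ideal.Quotient.mkₐ k J).toLinearMap) ?_
  rw [Submodule.disjoint_def]
  intro f hf hfJ
  have hfJ' : f ∈ J := Ideal.Quotient.eq_zero_iff_mem.mp hfJ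
  by_contra h0
  have hr : f ∈ restrictSupport k s := by
    rw [restrictSupport_eq_span]
    convert! hf using 2
    ext
    simp
  exact hs f hfJ' h0 (((mem_restrictSupport_iff k).mp hr) (mo.degree_mem_support h0))

theorem aeval_monomial_mul_mem_filtration {σ k A : Type*} [CommSemiring k] [CommSemiring A]
    [Algebra k A] (F : ℕ → Submodule k A) (y : σ → A) (c : ℕ)
    (hF : ∀ i M, ∀ t ∈ F M, y i * t ∈ F (M + c)) (α : σ →₀ ℕ) {M : ℕ} {t : A} (ht : t ∈ F M) :
    aeval y (monomial α (1 : k)) * t ∈ F (M + c * α.degree) := by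
  induction α using Finsupp.induction_linear generalizing M t with
  | zero => simpa using ht
  | add α β hα hβ =>
    have := hα (hβ ht)
    rw [← mul_assoc, ← map_mul, monomial_mul, mul_one] at this
    rwa [map_add, mul_add, add_comm (c * _), ← add_assoc]
  | single i e =>
    induction e with
    | zero => simpa using ht
    | succ e ih =>
      have := hF i _ _ ih
      simp only [aeval_monomial, map_one, one_mul, Finsupp.prod_single_index, pow_zero,
        Finsupp.degree_single] at this ⊢
      rw [pow_succ', mul_assoc, mul_add, mul_one, ← add_assoc]
      exact this

theorem card_le_of_mem_span_range {k A ι κ : Type*} [Field k] [AddCommGroup A] [Module k A]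
    [Finite ι] [Finite κ] {v : ι → A} (hv : LinearIndependent k v) {u : κ → A}
    (h : ∀ i, v i ∈ Submodule.span k (Set.range u)) : Nat.card ι ≤ Nat.card κ := by
  have := Fintype.ofFinite ι
  have := Fintype.ofFinite κ
  have : Module.Finite k (Submodule.span k (Set.range u)) :=
    Module.Finite.span_of_finite k (Set.finite_range u)
  rw [Nat.card_eq_fintype_card, Nat.card_eq_fintype_card]
  refine le_trans ?_ (finrank_range_le_card (R := k) u)
  refine LinearIndependent.fintype_card_le_finrank
    (b := fun i => (⟨v i, h i⟩ : Submodule.span k (Set.range u))) ?_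
  exact LinearIndependent.of_comp (Submodule.subtype _) hv

theorem finite_weight_le {σ : Type*} [Finite σ] {w : σ → ℕ} (hw : ∀ i, 0 < w i) (N : ℕ) :
    {b : σ →₀ ℕ | Finsupp.weight w b ≤ N}.Finite := by
  refine ((Set.Finite.pi' fun _ : σ => Set.finite_le_nat N).preimage
    (f := fun b : σ →₀ ℕ => ⇑b) DFunLike.coe_injective.injOn).subset fun b hb i => ?_
  exact (Finsupp.le_weight w (hw i).ne' b).trans hb

/-- The number of exponents of weight at most `N` lying in `s`. -/
def weightCount {σ : Type*} (w : σ → ℕ) (s : Set (σ →₀ ℕ)) (N : ℕ) : ℕ :=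
  Nat.card {b : σ →₀ ℕ // b ∈ s ∧ Finsupp.weight w b ≤ N}

theorem pow_le_weightCount {σ k : Type*} [Finite σ] [Field k] {J : Ideal (MvPolynomial σ k)}
    {w : σ → ℕ} (hw : ∀ i, 0 < w i) {s : Set (σ →₀ ℕ)}
    (hs : ∀ a : σ →₀ ℕ, Ideal.Quotient.mk J (monomial a 1) ∈ Submodule.span k
      ((fun b => Ideal.Quotient.mk J (monomial b (1 : k))) ''
        {b | b ∈ s ∧ Finsupp.weight w b ≤ Finsupp.weight w a}))
    {D : ℕ} (g : MvPolynomial (Fin D) k →ₐ[k] MvPolynomial σ k ⧸ J)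
    (hg : Function.Injective g) :
    ∃ C, ∀ N, (N + 1) ^ D ≤ weightCount w s (C * N) := by
  classical
  choose Y hY using fun i => Ideal.Quotient.mk_surjective (g (X i))
  let c := Finset.univ.sup fun i => (Y i).support.sup (Finsupp.weight w)
  have hc : ∀ i, ∀ m ∈ (Y i).support, Finsupp.weight w m ≤ c := fun i m hm =>
    (Finset.le_sup (f := Finsupp.weight w) hm).trans
      (Finset.le_sup (f := fun i => (Y i).support.sup (Finsupp.weight w)) (Finset.mem_univ i))
  let F : ℕ → Submodule k (MvPolynomial σ k ⧸ J) := fun M => Submodule.span k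
    ((fun b => Ideal.Quotient.mk J (monomial b (1 : k))) '' {b | Finsupp.weight w b ≤ M})
  have hF : ∀ i M, ∀ t ∈ F M, g (X i) * t ∈ F (M + c) := by
    intro i M t ht
    induction ht using Submodule.span_induction with
    | zero => simp
    | add _ _ _ _ h₁ h₂ => rw [mul_add]; exact add_mem h₁ h₂
    | smul r _ _ h => rw [mul_smul_comm]; exact Submodule.smul_mem _ _ h
    | mem t ht =>
      obtain ⟨b, hb, rfl⟩ := ht
      dsimp only
      rw [← hY, ← map_mul, (Y i).as_sum, Finset.sum_mul, map_sum]
      refine Submodule.sum_mem _ fun m hm => ?_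
      have : Ideal.Quotient.mk J (monomial m ((Y i).coeff m) * monomial b 1) =
          (Y i).coeff m • Ideal.Quotient.mk J (monomial (m + b) (1 : k)) := by
        rw [monomial_mul, mul_one, ← mul_one ((Y i).coeff m), ← smul_eq_mul, ← smul_monomial]
        simp only [smul_eq_mul, mul_one]
        rfl
      rw [this]
      refine Submodule.smul_mem _ _ (Submodule.subset_span ⟨_, ?_, rfl⟩)
      change Finsupp.weight w (m + b) ≤ M + c
      rw [map_add, add_comm]
      exact add_le_add hb (hc i m hm)
  have h1 : (1 : MvPolynomial σ k ⧸ J) ∈ F 0 := Submodule.subset_span ⟨0, by simp, by simp⟩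
  have hgX : ∀ p, aeval (fun i => g (X i)) p = g p := fun p =>
    DFunLike.congr_fun (aeval_unique g).symm p
  refine ⟨c * D, fun N => ?_⟩
  have hfin : Finite {b : σ →₀ ℕ // b ∈ s ∧ Finsupp.weight w b ≤ c * D * N} :=
    ((finite_weight_le hw (c * D * N)).subset fun _ hb => hb.2).to_subtype
  let e : (Fin D → Fin (N + 1)) → (Fin D →₀ ℕ) := fun α =>
    Finsupp.equivFunOnFinite.symm fun i => (α i : ℕ)
  have he : Function.Injective e := fun α β h => by
    ext i
    simpa [e] using DFunLike.congr_fun h i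
  have hli : LinearIndependent k fun α => g (monomial (e α) 1) :=
    ((basisMonomials (Fin D) k).linearIndependent.comp e he).map' g.toLinearMap
      (LinearMap.ker_eq_bot.mpr hg)
  have := card_le_of_mem_span_range hli
    (u := fun b : {b : σ →₀ ℕ // b ∈ s ∧ Finsupp.weight w b ≤ c * D * N} =>
      Ideal.Quotient.mk J (monomial b.1 (1 : k))) (fun α => by
    have hα := aeval_monomial_mul_mem_filtration F _ c hF (e α) h1
    rw [mul_one, zero_add, hgX] at hα
    refine Submodule.span_le.mpr ?_ hα
    rintro _ ⟨a, ha, rfl⟩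
    refine Submodule.span_mono ?_ (hs a)
    rintro _ ⟨b, ⟨hbs, hb⟩, rfl⟩
    refine ⟨⟨b, hbs, hb.trans (ha.trans ?_)⟩, rfl⟩
    rw [mul_assoc]
    refine Nat.mul_le_mul_left _ ?_
    rw [Finsupp.degree_eq_sum]
    refine (Finset.sum_le_card_nsmul _ _ N fun i _ => ?_).trans (by simp)
    exact Nat.lt_succ_iff.mp (α i).2)
  simpa [weightCount] using this

theorem weightCount_le_mul_pow {σ k A : Type*} [Finite σ] [Field k]
    [CommRing A] [Algebra k A] (x : σ → A) {w : σ → ℕ} (hw : ∀ i, 0 < w i) {s : Set (σ →₀ ℕ)}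
    (hs : LinearIndependent k fun b : s => aeval x (monomial (b : σ →₀ ℕ) (1 : k)))
    {D : ℕ} (g : MvPolynomial (Fin D) k →ₐ[k] A) (hg : g.Finite) :
    ∃ r C, ∀ N, weightCount w s N ≤ r * (C * (N + 1)) ^ D := by
  classical
  have := Fintype.ofFinite σ
  let := g.toRingHom.toAlgebra
  have hgalg : ∀ p (z : A), p • z = g p * z := fun _ _ => rfl
  obtain ⟨S, hS⟩ : (⊤ : Submodule (MvPolynomial (Fin D) k) A).FG :=
    Module.finite_def.mp hg
  let e : ∀ M, (Fin D → Fin (M + 1)) → (Fin D →₀ ℕ) := fun M α =>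
    Finsupp.equivFunOnFinite.symm fun i => (α i : ℕ)
  let u : ∀ M, (Fin D → Fin (M + 1)) × S → A := fun M x =>
    g (monomial (e M x.1) 1) * x.2
  let T : ℕ → Submodule k A := fun M => Submodule.span k (Set.range (u M))
  have hTgen : ∀ M (α : Fin D →₀ ℕ), (∀ i, α i ≤ M) → ∀ b ∈ S, g (monomial α 1) * b ∈ T M := by
    intro M α hα b hb
    refine Submodule.subset_span ⟨(fun i => ⟨α i, Nat.lt_succ_of_le (hα i)⟩, ⟨b, hb⟩), ?_⟩
    have : e M (fun i => ⟨α i, Nat.lt_succ_of_le (hα i)⟩) = α := by ext; simp [e]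
    simp only [u, this]
  have hTmul : ∀ M M' (α : Fin D →₀ ℕ), (∀ i, α i ≤ M) → ∀ t ∈ T M',
      g (monomial α 1) * t ∈ T (M' + M) := by
    intro M M' α hα t ht
    induction ht using Submodule.span_induction with
    | zero => simp
    | add _ _ _ _ h₁ h₂ => rw [mul_add]; exact add_mem h₁ h₂
    | smul r _ _ h => rw [mul_smul_comm]; exact Submodule.smul_mem _ _ h
    | mem t ht =>
      obtain ⟨⟨β, b⟩, rfl⟩ := ht
      simp only [u]
      rw [← mul_assoc, ← map_mul, monomial_mul, mul_one]
      refine hTgen _ _ (fun i => ?_) _ b.2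
      rw [Finsupp.add_apply, add_comm]
      exact add_le_add (Nat.lt_succ_iff.mp (β i).2) (hα i)
  have hTmono : Monotone T := fun M M' h => by
    refine Submodule.span_le.mpr ?_
    rintro _ ⟨⟨β, b⟩, rfl⟩
    exact hTgen _ _ (fun i => (Nat.lt_succ_iff.mp (β i).2).trans h) _ b.2
  have hT : ∀ z, ∃ M, z ∈ T M := by
    intro z
    have hz : z ∈ Submodule.span (MvPolynomial (Fin D) k) (S : Set A) :=
      hS ▸ Submodule.mem_top
    induction hz using Submodule.span_induction with
    | zero => exact ⟨0, zero_mem _⟩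
    | add _ _ _ _ h₁ h₂ =>
      obtain ⟨M₁, h₁⟩ := h₁
      obtain ⟨M₂, h₂⟩ := h₂
      exact ⟨max M₁ M₂, add_mem (hTmono (le_max_left _ _) h₁) (hTmono (le_max_right _ _) h₂)⟩
    | mem z hz => exact ⟨0, by simpa using hTgen 0 0 (by simp) z hz⟩
    | smul p z _ h =>
      obtain ⟨M, h⟩ := h
      refine ⟨M + p.support.sup (fun m => m.degree), ?_⟩
      have hp : p • z = ∑ m ∈ p.support, p.coeff m • (g (monomial m 1) * z) := by
        rw [hgalg]
        conv_lhs => rw [p.as_sum, map_sum, Finset.sum_mul]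
        refine Finset.sum_congr rfl fun m _ => ?_
        rw [← smul_mul_assoc, ← map_smul, smul_monomial, smul_eq_mul, mul_one]
      rw [hp]
      refine Submodule.sum_mem _ fun m hm => ?_
      refine Submodule.smul_mem _ _ (hTmul _ _ _ (fun i => ?_) _ h)
      exact (Finsupp.le_degree i m).trans (Finset.le_sup (f := fun m => m.degree) hm)
  choose E hE using hT
  let c := Finset.univ.sup fun i => S.sup fun b => E (x i * b)
  have hc : ∀ i, ∀ b ∈ S, x i * b ∈ T c := fun i b hb => hTmono
    ((Finset.le_sup (f := fun b => E (x i * b)) hb).trans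
      (Finset.le_sup (f := fun i => S.sup fun b => E (x i * b)) (Finset.mem_univ i))) (hE _)
  have hx : ∀ i M, ∀ t ∈ T M, x i * t ∈ T (M + c) := by
    intro i M t ht
    induction ht using Submodule.span_induction with
    | zero => simp
    | add _ _ _ _ h₁ h₂ => rw [mul_add]; exact add_mem h₁ h₂
    | smul r _ _ h => rw [mul_smul_comm]; exact Submodule.smul_mem _ _ h
    | mem t ht =>
      obtain ⟨⟨β, b⟩, rfl⟩ := ht
      simp only [u]
      rw [mul_left_comm, add_comm]
      exact hTmul _ _ _ (fun i => Nat.lt_succ_iff.mp (β i).2) _ (hc i b b.2)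
  refine ⟨S.card, E 1 + c + 1, fun N => ?_⟩
  have hfin : Finite {b : σ →₀ ℕ // b ∈ s ∧ Finsupp.weight w b ≤ N} :=
    ((finite_weight_le hw N).subset fun _ hb => hb.2).to_subtype
  have := card_le_of_mem_span_range (u := u (E 1 + c * N))
    (hs.comp (fun b : {b : σ →₀ ℕ // b ∈ s ∧ Finsupp.weight w b ≤ N} => (⟨b.1, b.2.1⟩ : s))
      fun a b h => Subtype.ext (congrArg (fun z : s => z.1) h)) (fun b => by
    have hb := aeval_monomial_mul_mem_filtration T x c hx b.1 (hE 1)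
    rw [mul_one] at hb
    refine hTmono (Nat.add_le_add_left (Nat.mul_le_mul_left _ (le_trans ?_ b.2.2)) _) hb
    rw [Finsupp.degree_eq_sum, Finsupp.weight_apply, Finsupp.sum_fintype _ _ (by simp)]
    exact Finset.sum_le_sum fun i _ => by simpa using Nat.le_mul_of_pos_right _ (hw i))
  refine this.trans ?_
  rw [Nat.card_prod, Nat.card_fun, mul_comm]
  simp only [Nat.card_eq_fintype_card, Fintype.card_fin, Fintype.card_coe]
  refine Nat.mul_le_mul_left _ (Nat.pow_le_pow_left ?_ _)
  nlinarith [Nat.zero_le (E 1 * N), Nat.zero_le N]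

theorem ringKrullDim_quotient_le_of_degree_le {σ k : Type*} [Finite σ] [Field k]
    (mo : MonomialOrder σ) {J₁ J₂ : Ideal (MvPolynomial σ k)} {G : Finset (MvPolynomial σ k)}
    (hGJ : ∀ g ∈ G, g ∈ J₁) (hG0 : ∀ g ∈ G, g ≠ 0)
    (hG : ∀ f ∈ J₂, f ≠ 0 → ∃ g ∈ G, mo.degree g ≤ mo.degree f) :
    ringKrullDim (MvPolynomial σ k ⧸ J₁) ≤ ringKrullDim (MvPolynomial σ k ⧸ J₂) := by
  classical
  by_cases h₁ : J₁ = ⊤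
  · have : Subsingleton (MvPolynomial σ k ⧸ J₁) := Ideal.Quotient.subsingleton_iff.mpr h₁
    rw [ringKrullDim_eq_bot_of_subsingleton]
    exact bot_le
  have h₂ : J₂ ≠ ⊤ := by
    rintro rfl
    obtain ⟨g, hg, hdeg⟩ := hG 1 trivial one_ne_zero
    rw [mo.degree_one] at hdeg
    have hgC := mo.eq_C_of_degree_eq_zero (le_antisymm hdeg (by simp))
    have hu : IsUnit g := by
      rw [hgC]
      exact (isUnit_iff_ne_zero.mpr (mo.leadingCoeff_ne_zero_iff.mpr (hG0 g hg))).map C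
    exact h₁ (Ideal.eq_top_of_isUnit_mem _ (hGJ g hg) hu)
  have : Nontrivial (MvPolynomial σ k ⧸ J₁) := Ideal.Quotient.nontrivial_iff.mpr h₁
  have : Nontrivial (MvPolynomial σ k ⧸ J₂) := Ideal.Quotient.nontrivial_iff.mpr h₂
  obtain ⟨D₁, g₁, hg₁, hg₁'⟩ := exists_finite_inj_algHom_of_fg k (MvPolynomial σ k ⧸ J₁)
  obtain ⟨D₂, g₂, hg₂, hg₂'⟩ := exists_finite_inj_algHom_of_fg k (MvPolynomial σ k ⧸ J₂)
  rw [← ringKrullDim_eq_of_algHom_finite g₁ hg₁ hg₁', ← ringKrullDim_eq_of_algHom_finite g₂ hg₂ hg₂']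
  obtain ⟨w, hw, hwG⟩ := mo.exists_pos_weight
    (G.biUnion fun g => g.support.image fun m => (m, mo.degree g)) (by
      intro p hp
      obtain ⟨g, hg, hp⟩ := Finset.mem_biUnion.mp hp
      obtain ⟨m, hm, rfl⟩ := Finset.mem_image.mp hp
      exact mo.le_degree hm)
  let s : Set (σ →₀ ℕ) := {b | ∀ g ∈ G, ¬ mo.degree g ≤ b}
  obtain ⟨C₁, hC₁⟩ := pow_le_weightCount (s := s) hw
    (mk_monomial_mem_span_standard mo hGJ hG0 fun g hg m hm => hwG (m, mo.degree g)
      (Finset.mem_biUnion.mpr ⟨g, hg, Finset.mem_image_of_mem _ hm⟩)) g₁ hg₁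
  obtain ⟨r, C₂, hC₂⟩ := weightCount_le_mul_pow (s := s) (fun i => Ideal.Quotient.mk J₂ (X i)) hw
    (by
      have := linearIndependent_mk_standard mo J₂ s fun f hf hf0 hfs => by
        obtain ⟨g, hg, hgf⟩ := hG f hf hf0
        exact hfs g hg hgf
      convert! this using 2 with b
      exact DFunLike.congr_fun (aeval_unique (Ideal.Quotient.mkₐ k J₂)).symm _) g₂ hg₂'
  have hle : D₁ ≤ D₂ := by
    by_contra! hlt
    set K := r * (C₂ * (C₁ + 1)) ^ D₂ with hK
    have h1 : (K + 1) ^ (D₂ + 1) ≤ K * (K + 1) ^ D₂ :=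
      calc (K + 1) ^ (D₂ + 1) ≤ (K + 1) ^ D₁ := Nat.pow_le_pow_right (by omega) hlt
        _ ≤ r * (C₂ * (C₁ * K + 1)) ^ D₂ := (hC₁ K).trans (hC₂ _)
        _ ≤ r * (C₂ * ((C₁ + 1) * (K + 1))) ^ D₂ := by gcongr; nlinarith
        _ = K * (K + 1) ^ D₂ := by rw [← mul_assoc C₂, mul_pow, ← mul_assoc, ← hK]
    rw [pow_succ'] at h1
    have := Nat.le_of_mul_le_mul_right h1 (by positivity)
    omega
  simp only [MvPolynomial.ringKrullDim_of_isNoetherianRing, ringKrullDim_eq_zero_of_field,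
    zero_add, Nat.card_eq_fintype_card, Fintype.card_fin]
  exact_mod_cast hle

theorem span_mLT_eq_span_monomial {σ R : Type*} [CommRing R] (mo : MonomialOrder σ)
    (s : Set (MvPolynomial σ R)) (hs : ∀ f ∈ s, IsUnit (mLC mo f)) :
    Ideal.span (mLT mo '' s) = Ideal.span ((fun a => monomial a (1 : R)) '' (mDegree mo '' s)) := by
  apply le_antisymm <;> rw [Ideal.span_le]
  · rintro _ ⟨f, hf, rfl⟩
    have : mLT mo f = C (mLC mo f) * monomial (mDegree mo f) 1 := by
      rw [C_mul_monomial, mul_one, mLT]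
    rw [this]
    exact Ideal.mul_mem_left _ _ (Ideal.subset_span ⟨_, ⟨f, hf, rfl⟩, rfl⟩)
  · rintro _ ⟨_, ⟨f, hf, rfl⟩, rfl⟩
    obtain ⟨u, hu⟩ := hs f hf
    have : monomial (mDegree mo f) (1 : R) = C (↑u⁻¹ : R) * mLT mo f := by
      rw [mLT, C_mul_monomial, ← hu, Units.inv_mul]
    dsimp only
    rw [this]
    exact Ideal.mul_mem_left _ _ (Ideal.subset_span ⟨f, hf, rfl⟩)

theorem degree_map_of_leadingCoeff_ne_zero {σ R R' : Type*} [CommSemiring R] [CommSemiring R']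
    (mo : MonomialOrder σ) (φ : R →+* R') {f : MvPolynomial σ R}
    (hf : φ (mo.leadingCoeff f) ≠ 0) : mo.degree (map φ f) = mo.degree f := by
  apply mo.toSyn.injective
  apply le_antisymm
  · exact mo.degree_le_iff.mpr fun c hc => mo.le_degree (support_map_subset φ f hc)
  · refine mo.le_degree (mem_support_iff.mpr ?_)
    rwa [coeff_map]

section Fiber

variable {S : Type} [TopologicalSpace S] {n : ℕ} {mo : MonomialOrder (Fin n)}
  {I : Ideal (MvPolynomial (Fin n) C(S, ℂ))} {G : Finset (MvPolynomial (Fin n) C(S, ℂ))}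

theorem fiberMap_surjective (n : ℕ) (s : S) : Function.Surjective (fiberMap n s) :=
  map_surjective _ fun c => ⟨ContinuousMap.const S c, rfl⟩

namespace IsGroebnerBasis

theorem isUnit_leadingCoeff (hG : IsGroebnerBasis S mo I G) {g} (hg : g ∈ G) :
    IsUnit (mo.leadingCoeff g) :=
  (ContinuousMap.isUnit_iff_forall_ne_zero _).mpr (hG.2.1 g hg)

theorem degree_fiberMap (hG : IsGroebnerBasis S mo I G) {g} (hg : g ∈ G) (s : S) :
    mo.degree (fiberMap n s g) = mo.degree g :=
  degree_map_of_leadingCoeff_ne_zero mo (evalAt s) (hG.2.1 g hg s)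

theorem fiberMap_mem (hG : IsGroebnerBasis S mo I G) {g} (hg : g ∈ G) (s : S) :
    fiberMap n s g ∈ I.map (fiberMap n s) :=
  Ideal.mem_map_of_mem _ (hG.1 ▸ Ideal.subset_span hg)

theorem fiberMap_ne_zero (hG : IsGroebnerBasis S mo I G) {g} (hg : g ∈ G) (s : S) :
    fiberMap n s g ≠ 0 := fun h => hG.2.1 g hg s <| by
  have := congrArg (coeff (mo.degree g)) h
  rwa [fiberMap, coeff_map, coeff_zero] at this

theorem exists_degree_le (hG : IsGroebnerBasis S mo I G) {f} (hf : f ∈ I) (hf0 : f ≠ 0) :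
    ∃ g ∈ G, mo.degree g ≤ mo.degree f := by
  have hmem : mLT mo f ∈ ltIdeal mo I := Ideal.subset_span ⟨f, hf, hf0, rfl⟩
  rw [← hG.2.2, span_mLT_eq_span_monomial mo _ fun g hg => hG.isUnit_leadingCoeff hg,
    mem_ideal_span_monomial_image] at hmem
  obtain ⟨_, ⟨g, hg, rfl⟩, hle⟩ := hmem (mDegree mo f) (by
    rw [mLT, mem_support_iff, coeff_monomial, if_pos rfl]
    exact mo.leadingCoeff_ne_zero_iff.mpr hf0)
  exact ⟨g, hg, hle⟩

theorem exists_degree_le_of_mem_fiber (hG : IsGroebnerBasis S mo I G) (s : S) {h}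
    (hh : h ∈ I.map (fiberMap n s)) (h0 : h ≠ 0) : ∃ g ∈ G, mo.degree g ≤ mo.degree h := by
  obtain ⟨f, hf, rfl⟩ := (Ideal.mem_map_iff_of_surjective _ (fiberMap_surjective n s)).mp hh
  clear hh
  induction f using (InvImage.wf (fun f => mo.toSyn (mo.degree f)) wellFounded_lt).induction with
  | _ f ih =>
    have hf0 : f ≠ 0 := by rintro rfl; exact h0 (map_zero _)
    obtain ⟨g, hg, hgf⟩ := hG.exists_degree_le hf hf0
    by_cases hlc : evalAt s (mo.leadingCoeff f) = 0
    · have hdeg : mo.degree f ≠ 0 := fun hd => h0 <| by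
        rw [mo.eq_C_of_degree_eq_zero hd, fiberMap, map_C, hlc, C_0]
      have hu := hG.isUnit_leadingCoeff hg
      have heq : fiberMap n s (mo.reduce hu f) = fiberMap n s f := by
        rw [MonomialOrder.reduce, map_sub, map_mul]
        simp only [fiberMap, map_monomial, map_mul, hlc, mul_zero, monomial_zero, zero_mul,
          sub_zero]
      rw [← heq] at h0 ⊢
      refine ih _ (mo.degree_reduce_lt hu hgf hdeg) ?_ h0
      rw [MonomialOrder.reduce]
      exact Ideal.sub_mem (α := MvPolynomial (Fin n) C(S, ℂ)) I hf (Ideal.mul_mem_left _ _ (hG.1 ▸ Ideal.subset_span hg))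
    · exact ⟨g, hg, hgf.trans_eq (degree_map_of_leadingCoeff_ne_zero mo (evalAt s) hlc).symm⟩

theorem ltIdeal_fiber (hG : IsGroebnerBasis S mo I G) (s : S) :
    ltIdeal mo (I.map (fiberMap n s)) =
      Ideal.span ((fun a => monomial a (1 : ℂ)) '' (mo.degree '' (G : Set (MvPolynomial (Fin n) C(S, ℂ))))) := by
  have hlt : ltIdeal mo (I.map (fiberMap n s)) =
      Ideal.span (mLT mo '' {f | f ∈ I.map (fiberMap n s) ∧ f ≠ 0}) := by
    rw [ltIdeal]
    congr 1
    ext p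
    simp only [Set.mem_ofPred_eq, Set.mem_image, and_assoc, eq_comm]
  rw [hlt, span_mLT_eq_span_monomial mo _ fun f hf =>
    isUnit_iff_ne_zero.mpr (mo.leadingCoeff_ne_zero_iff.mpr hf.2)]
  apply le_antisymm
  · rw [Ideal.span_le]
    rintro _ ⟨_, ⟨f, ⟨hf, hf0⟩, rfl⟩, rfl⟩
    obtain ⟨g, hg, hgf⟩ := hG.exists_degree_le_of_mem_fiber s hf hf0
    rw [SetLike.mem_coe, mem_ideal_span_monomial_image]
    intro a ha
    rw [Finset.mem_singleton.mp (support_monomial_subset ha)]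
    exact ⟨_, ⟨g, hg, rfl⟩, hgf⟩
  · refine Ideal.span_mono (Set.image_mono ?_)
    rintro _ ⟨g, hg, rfl⟩
    exact ⟨fiberMap n s g, ⟨hG.fiberMap_mem hg s, hG.fiberMap_ne_zero hg s⟩,
      hG.degree_fiberMap hg s⟩

theorem ringKrullDim_fiber_le (hG : IsGroebnerBasis S mo I G) (s s' : S) :
    ringKrullDim (MvPolynomial (Fin n) ℂ ⧸ I.map (fiberMap n s)) ≤
      ringKrullDim (MvPolynomial (Fin n) ℂ ⧸ I.map (fiberMap n s')) := by
  classical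
  refine ringKrullDim_quotient_le_of_degree_le mo (G := G.image (fiberMap n s)) ?_ ?_ ?_
  · simpa only [Finset.forall_mem_image] using fun g hg => hG.fiberMap_mem hg s
  · simpa only [Finset.forall_mem_image] using fun g hg => hG.fiberMap_ne_zero hg s
  · intro f hf hf0
    obtain ⟨g, hg, hgf⟩ := hG.exists_degree_le_of_mem_fiber s' hf hf0
    exact ⟨_, Finset.mem_image_of_mem _ hg, (hG.degree_fiberMap hg s).trans_le hgf⟩

end IsGroebnerBasis

end Fiber

/-- over a path-connected space, a Groebner ideal has the same ideal of leading
terms in every fibre, and hence the Krull dimension of `ℂ[x₁,…,xₙ]/I|_s` is independent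
of `s`. -/
theorem stmt4 (S : Type) [TopologicalSpace S] [PathConnectedSpace S] (n : ℕ)
    (mo : MonomialOrder (Fin n)) (I : Ideal (MvPolynomial (Fin n) C(S, ℂ)))
    (hI : IsGroebnerIdeal S mo I) (s s' : S) :
    ltIdeal mo (I.map (fiberMap n s)) = ltIdeal mo (I.map (fiberMap n s')) ∧
    ringKrullDim (MvPolynomial (Fin n) ℂ ⧸ I.map (fiberMap n s)) =
      ringKrullDim (MvPolynomial (Fin n) ℂ ⧸ I.map (fiberMap n s')) := by
  obtain ⟨G, hG⟩ := hI
  exact ⟨(hG.ltIdeal_fiber s).trans (hG.ltIdeal_fiber s').symm,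
    le_antisymm (hG.ringKrullDim_fiber_le s s') (hG.ringKrullDim_fiber_le s' s)⟩
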